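/- arXiv:2105.00018 — 2 statements merged into one kernel-verified Lean document; each statement's English description precedes it below -/
import Mathlib

section
/- Assume in addition that P(𝚣 > log 2) > 0 and P(𝚣 < −log 2) > 0. Then there exist C > 0 and k₀ > 0 such that for every k ≥ k₀, sup_{x∈ℝ} E_x[τ_k] ≤ (1/2) k² (log k)^C, where τ_k is the first exit time of the chain X from (−k, k). -/
open MeasureTheory ProbabilityTheory Real Filter Set
open scoped ENNReal

noncomputable def hkfun (k x : ℝ) : ℝ :=
  Real.log ((Real.exp (-k) + Real.exp x) / (1 + Real.exp (x - k)))

noncomputable def chainX (k : ℝ) (zs : ℕ → ℝ) (y : ℝ) : ℕ → ℝ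
  | 0 => y
  | n + 1 => zs (n + 1) + hkfun k (chainX k zs y n)

/-- First exit time of the chain from (-k, k), with value ∞ if the chain never exits. -/
noncomputable def tauK (k : ℝ) (zs : ℕ → ℝ) (y : ℝ) : ℝ≥0∞ :=
  ⨅ (n : ℕ) (_ : k ≤ |chainX k zs y n|), (n : ℝ≥0∞)

/-- The exponential `exp (n s)`, frozen at the value it has for `s = M`. -/
noncomputable def expTrunc (n : ℕ) (M s : ℝ) : ℝ :=
  min (Real.exp (n * s)) (Real.exp (n * M))

lemma expTrunc_pos (n : ℕ) (M s : ℝ) : 0 < expTrunc n M s :=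
  lt_min (Real.exp_pos _) (Real.exp_pos _)

lemma expTrunc_le (n : ℕ) (M s : ℝ) : expTrunc n M s ≤ Real.exp (n * M) := min_le_right _ _

lemma expTrunc_neg_le (n : ℕ) (M u : ℝ) : expTrunc n M (-u) ≤ Real.exp (-u) ^ n := by
  rw [← Real.exp_nat_mul]
  exact min_le_left _ _

lemma monotone_expTrunc (n : ℕ) (M : ℝ) : Monotone (expTrunc n M) := fun s t hst =>
  min_le_min (Real.exp_le_exp.2 (by gcongr)) le_rfl

lemma integrable_of_measurable_of_mem_Icc {μ : Measure ℝ} [IsFiniteMeasure μ] {f : ℝ → ℝ} {D : ℝ}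
    (hf : Measurable f) (h0 : ∀ x, 0 ≤ f x) (hD : ∀ x, f x ≤ D) : Integrable f μ :=
  Integrable.of_bound hf.aestronglyMeasurable D
    (ae_of_all _ fun x => by rw [Real.norm_eq_abs, abs_of_nonneg (h0 x)]; exact hD x)

lemma integrable_expTrunc_comp {μ : Measure ℝ} [IsFiniteMeasure μ] (n : ℕ) (M : ℝ) {g : ℝ → ℝ}
    (hg : Measurable g) : Integrable (fun y => expTrunc n M (g y)) μ :=
  integrable_of_measurable_of_mem_Icc ((monotone_expTrunc n M).measurable.comp hg)
    (fun _ => (expTrunc_pos _ _ _).le) fun _ => expTrunc_le _ _ _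

lemma mul_integral_expTrunc_le {μ : Measure ℝ} [IsFiniteMeasure μ] (n : ℕ) (M u : ℝ) :
    (Real.exp (-u) / (1 + Real.exp (-u))) ^ n * ∫ y, expTrunc n M y ∂μ
      ≤ ∫ y, expTrunc n M (y - Real.log (1 + Real.exp (-u)) - u) ∂μ := by
  have hpos := Real.exp_pos (-u)
  have hr0 : 0 ≤ Real.exp (-u) / (1 + Real.exp (-u)) := by positivity
  have hr1 : Real.exp (-u) / (1 + Real.exp (-u)) ≤ 1 := by
    rw [div_le_one (by positivity)]; linarith
  rw [← integral_const_mul]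
  refine integral_mono ((integrable_expTrunc_comp n M measurable_id).const_mul _)
    (integrable_expTrunc_comp n M (by fun_prop)) fun y => ?_
  have he : Real.exp (n * (y - Real.log (1 + Real.exp (-u)) - u))
      = (Real.exp (-u) / (1 + Real.exp (-u))) ^ n * Real.exp (n * y) := by
    rw [Real.exp_nat_mul, Real.exp_nat_mul, ← mul_pow]
    congr 1
    rw [sub_eq_add_neg, Real.exp_add, Real.exp_sub, Real.exp_log (by positivity)]
    ring
  have hle : (Real.exp (-u) / (1 + Real.exp (-u))) ^ n ≤ 1 := pow_le_one₀ hr0 hr1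
  have hnn : 0 ≤ (Real.exp (-u) / (1 + Real.exp (-u))) ^ n := pow_nonneg hr0 n
  refine le_min ?_ ?_
  · rw [he]
    exact mul_le_mul_of_nonneg_left (min_le_left _ _) hnn
  · calc _ ≤ 1 * expTrunc n M y := by
          exact mul_le_mul_of_nonneg_right hle (expTrunc_pos _ _ _).le
      _ ≤ _ := by rw [one_mul]; exact expTrunc_le _ _ _

/-- A centred law charging `(log 2, ∞)` satisfies a strict Jensen inequality for `exp`, and the
strictness survives truncation. -/
lemma exists_one_lt_integral_expTrunc {μ : Measure ℝ} [IsProbabilityMeasure μ]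
    (hint : Integrable (fun y => y) μ) (hmean : ∫ y, y ∂μ = 0) (hpos : 0 < μ (Ioi (Real.log 2))) :
    ∃ M : ℝ, 0 ≤ M ∧ 1 < ∫ y, expTrunc 1 M y ∂μ := by
  have hl2 : Real.log 2 < 1 := by have := Real.log_two_lt_d9; linarith
  have hp : 0 < μ.real (Ioi (Real.log 2)) := by
    rw [measureReal_def]; exact ENNReal.toReal_pos hpos.ne' (measure_ne_top _ _)
  have hlim : Tendsto (fun M : ℝ => ∫ y, min y M ∂μ) atTop (nhds (∫ y, y ∂μ)) := by
    refine tendsto_integral_filter_of_dominated_convergence (fun y => |y|) ?_ ?_ hint.abs ?_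
    · exact Eventually.of_forall fun M => by fun_prop
    · filter_upwards [eventually_ge_atTop 0] with M hM
      refine ae_of_all _ fun y => ?_
      rw [Real.norm_eq_abs]
      rcases min_choice y M with h | h
      · rw [h]
      · rw [h, abs_of_nonneg hM]
        exact (min_eq_right_iff.1 h).trans (le_abs_self y)
    · refine ae_of_all _ fun y => tendsto_const_nhds.congr' ?_
      filter_upwards [eventually_ge_atTop y] with M hM
      rw [min_eq_left hM]
  rw [hmean] at hlim
  have hneg : -((1 - Real.log 2) * μ.real (Ioi (Real.log 2))) < 0 := by
    have : 0 < 1 - Real.log 2 := by linarith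
    have := mul_pos this hp
    linarith
  obtain ⟨M, hM, hM1⟩ := ((hlim.eventually_const_lt hneg).and (eventually_gt_atTop 1)).exists
  refine ⟨M, by linarith, ?_⟩
  have hmin : Integrable (fun y => min y M) μ := hint.inf (integrable_const M)
  have hind : Integrable (fun y => (Ioi (Real.log 2)).indicator (fun _ => 1 - Real.log 2) y) μ :=
    (integrable_const _).indicator measurableSet_Ioi
  have hle : ∫ y, (1 + min y M + (Ioi (Real.log 2)).indicator (fun _ => 1 - Real.log 2) y) ∂μ
      ≤ ∫ y, expTrunc 1 M y ∂μ := by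
    refine integral_mono (((integrable_const _).add hmin).add hind)
      (integrable_expTrunc_comp 1 M measurable_id) fun y => ?_
    have hE : expTrunc 1 M y = Real.exp (min y M) := by
      simp [expTrunc, Real.exp_monotone.map_min]
    simp only [hE]
    by_cases hy : y ∈ Ioi (Real.log 2)
    · rw [indicator_of_mem hy]
      have hm : Real.log 2 < min y M := lt_min hy (by linarith)
      have h1 := Real.add_one_le_exp (min y M - Real.log 2)
      have h2 : Real.exp (min y M) = 2 * Real.exp (min y M - Real.log 2) := by
        rw [Real.exp_sub, Real.exp_log (by norm_num)]; ring
      rw [h2]; linarith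
    · rw [indicator_of_notMem hy]
      have := Real.add_one_le_exp (min y M)
      linarith
  rw [integral_add (f := fun y => 1 + min y M) ((integrable_const _).add hmin) hind,
    integral_add (integrable_const _) hmin,
    integral_indicator_const _ measurableSet_Ioi] at hle
  simp only [integral_const, probReal_univ, smul_eq_mul, one_mul] at hle
  linarith

lemma exists_two_mul_two_pow_le_integral_expTrunc {μ : Measure ℝ} [IsProbabilityMeasure μ]
    (hpos : 0 < μ (Ioi (Real.log 2))) :
    ∃ (n : ℕ) (b : ℝ), 2 * 2 ^ n ≤ ∫ y, expTrunc n b y ∂μ := by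
  obtain ⟨b, hb, hpb⟩ : ∃ b, Real.log 2 < b ∧ 0 < μ (Ioi b) := by
    by_contra! hcon
    have hun : Ioi (Real.log 2) = ⋃ m : ℕ, Ioi (Real.log 2 + 1 / ((m : ℝ) + 1)) := by
      ext y
      simp only [mem_Ioi, mem_iUnion]
      constructor
      · intro hy
        obtain ⟨m, hm⟩ := exists_nat_one_div_lt (sub_pos.2 hy)
        exact ⟨m, by linarith⟩
      · rintro ⟨m, hm⟩
        have : (0 : ℝ) < 1 / ((m : ℝ) + 1) := by positivity
        linarith
    rw [hun] at hpos
    refine hpos.ne' (measure_iUnion_null fun m => ?_)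
    refine nonpos_iff_eq_zero.1 (hcon _ ?_)
    have : (0 : ℝ) < 1 / ((m : ℝ) + 1) := by positivity
    linarith
  have hp : 0 < μ.real (Ioi b) := by
    rw [measureReal_def]; exact ENNReal.toReal_pos hpb.ne' (measure_ne_top _ _)
  have hgt : 1 < Real.exp (b - Real.log 2) := Real.one_lt_exp_iff.2 (by linarith)
  obtain ⟨n, hn⟩ := pow_unbounded_of_one_lt (2 / μ.real (Ioi b)) hgt
  refine ⟨n, b, ?_⟩
  have hle : ∫ y, (Ioi b).indicator (fun _ => Real.exp (n * b)) y ∂μ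
      ≤ ∫ y, expTrunc n b y ∂μ := by
    refine integral_mono ((integrable_const _).indicator measurableSet_Ioi)
      (integrable_expTrunc_comp n b measurable_id) fun y => ?_
    by_cases hy : y ∈ Ioi b
    · simp only [indicator_of_mem hy]
      refine le_min (Real.exp_le_exp.2 ?_) le_rfl
      have : b < y := hy
      gcongr
    · simp only [indicator_of_notMem hy]
      exact (expTrunc_pos _ _ _).le
  rw [integral_indicator_const _ measurableSet_Ioi, smul_eq_mul] at hle
  refine le_trans ?_ hle
  rw [div_lt_iff₀ hp] at hn
  have he : Real.exp (n * b) = Real.exp (b - Real.log 2) ^ n * 2 ^ n := by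
    rw [Real.exp_nat_mul, ← mul_pow, Real.exp_sub, Real.exp_log (by norm_num)]
    congr 1; ring
  rw [he]
  have h2 : (0 : ℝ) < 2 ^ n := by positivity
  nlinarith

/-- A bounded increasing function whose expected increment along the chain, seen from the boundary
at distance `u`, is at least of the order `exp (-u)` of the inward drift. -/
lemma exists_boundary_gain {μ : Measure ℝ} [IsProbabilityMeasure μ]
    (hint : Integrable (fun y => y) μ) (hmean : ∫ y, y ∂μ = 0) (hpos : 0 < μ (Ioi (Real.log 2))) :
    ∃ (G : ℝ → ℝ) (c D : ℝ), 0 < c ∧ Monotone G ∧ (∀ s, 0 ≤ G s) ∧ (∀ s, G s ≤ D) ∧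
      ∀ u, 0 ≤ u → G (-u) + c * Real.exp (-u)
        ≤ ∫ y, G (y - Real.log (1 + Real.exp (-u)) - u) ∂μ := by
  obtain ⟨M, hM0, hM⟩ := exists_one_lt_integral_expTrunc hint hmean hpos
  obtain ⟨n, b, hn⟩ := exists_two_mul_two_pow_le_integral_expTrunc hpos
  set m := ∫ y, expTrunc 1 M y ∂μ with hm
  obtain ⟨a, ha, ham⟩ : ∃ a, 0 < a ∧ 1 + 2 * a = m := ⟨(m - 1) / 2, by linarith, by ring⟩
  have hA : 0 < 2 / a ^ n := by positivity
  refine ⟨fun s => expTrunc 1 M s + 2 / a ^ n * expTrunc n b s, min (a / 2) 1,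
    Real.exp ((1 : ℕ) * M) + 2 / a ^ n * Real.exp (n * b), by positivity, ?_, ?_, ?_, ?_⟩
  · exact (monotone_expTrunc 1 M).add ((monotone_expTrunc n b).const_mul hA.le)
  · intro s
    have := expTrunc_pos 1 M s
    have := expTrunc_pos n b s
    positivity
  · intro s
    exact add_le_add (expTrunc_le 1 M s) (mul_le_mul_of_nonneg_left (expTrunc_le n b s) hA.le)
  · intro u hu
    rw [integral_add (integrable_expTrunc_comp _ _ (by fun_prop))
      ((integrable_expTrunc_comp _ _ (by fun_prop)).const_mul _), integral_const_mul]
    have h1 := mul_integral_expTrunc_le (μ := μ) 1 M u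
    have h2 := mul_integral_expTrunc_le (μ := μ) n b u
    have h3 := expTrunc_neg_le 1 M u
    have h4 := expTrunc_neg_le n b u
    rw [← hm, ← ham] at h1
    have ht0 : 0 < Real.exp (-u) := Real.exp_pos _
    have ht1 : Real.exp (-u) ≤ 1 := Real.exp_le_one_iff.2 (by linarith)
    set t := Real.exp (-u) with ht
    rw [pow_one] at h1 h3
    have h5 : 2 * t ^ n ≤ ∫ y, expTrunc n b (y - Real.log (1 + t) - u) ∂μ := by
      refine le_trans ?_ h2
      calc 2 * t ^ n = (t / 2) ^ n * (2 * 2 ^ n) := by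
            rw [div_pow]; field_simp
        _ ≤ (t / (1 + t)) ^ n * (2 * 2 ^ n) := by
            gcongr; linarith
        _ ≤ _ := by gcongr
    have ht2 : min (a / 2) 1 * t ≤ a / 2 * t := by
      gcongr; exact min_le_left _ _
    have ht3 : min (a / 2) 1 * t ≤ 1 * t := by
      gcongr; exact min_le_right _ _
    have h6 : 2 / a ^ n * (2 * t ^ n)
        ≤ 2 / a ^ n * ∫ y, expTrunc n b (y - Real.log (1 + t) - u) ∂μ := by gcongr
    have h7 : 2 / a ^ n * expTrunc n b (-u) ≤ 2 / a ^ n * t ^ n := by gcongr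
    have h8 : 0 < 2 / a ^ n * t ^ n := by positivity
    rcases le_total t a with hta | hta
    · have h9 : t * (1 + a / 2) ≤ t / (1 + t) * (1 + 2 * a) := by
        rw [div_mul_eq_mul_div, le_div_iff₀ (by positivity), mul_assoc]
        gcongr
        nlinarith
      linarith
    · have h9 : 2 ≤ 2 / a ^ n * t ^ n := by
        rw [div_mul_eq_mul_div, le_div_iff₀ (by positivity)]
        gcongr
      have h10 : 0 ≤ t / (1 + t) * (1 + 2 * a) := by positivity
      linarith

lemma exists_forall_integral_min_sq_ge {μ : Measure ℝ} [IsProbabilityMeasure μ]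
    (hint : Integrable (fun y => y) μ) (hmean : ∫ y, y ∂μ = 0)
    (hsq : Integrable (fun y => y ^ 2) μ) (hvar : 0 < ∫ y, y ^ 2 ∂μ) :
    ∃ k₁ : ℝ, ∀ k ≥ k₁, ∀ h : ℝ, |h| ≤ k →
      h ^ 2 + (∫ y, y ^ 2 ∂μ) / 2 ≤ ∫ y, min ((y + h) ^ 2) (4 * k ^ 2) ∂μ := by
  have hms : ∀ k : ℝ, MeasurableSet {y : ℝ | k ≤ |y|} := fun k =>
    measurableSet_le measurable_const (by fun_prop)
  have hlim : Tendsto (fun k : ℝ => ∫ y, {y : ℝ | k ≤ |y|}.indicator (fun y => 4 * y ^ 2) y ∂μ)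
      atTop (nhds (∫ _, (0 : ℝ) ∂μ)) := by
    refine tendsto_integral_filter_of_dominated_convergence (fun y => 4 * y ^ 2) ?_ ?_
      (hsq.const_mul 4) ?_
    · exact Eventually.of_forall fun k =>
        ((hsq.const_mul 4).indicator (hms k)).aestronglyMeasurable
    · refine Eventually.of_forall fun k => ae_of_all _ fun y => ?_
      refine (norm_indicator_le_norm_self _ _).trans ?_
      rw [Real.norm_eq_abs, abs_of_nonneg (by positivity)]
    · refine ae_of_all _ fun y => tendsto_const_nhds.congr' ?_
      filter_upwards [eventually_gt_atTop |y|] with k hk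
      rw [indicator_of_notMem]
      simpa using hk
  rw [integral_zero] at hlim
  obtain ⟨k₁, hk₁⟩ := eventually_atTop.1 (hlim.eventually_lt_const (half_pos hvar))
  refine ⟨k₁, fun k hk h hh => ?_⟩
  have hk' := hk₁ k hk
  have hind : Integrable ({y : ℝ | k ≤ |y|}.indicator (fun y => 4 * y ^ 2)) μ :=
    (hsq.const_mul 4).indicator (hms k)
  have hexp : Integrable (fun y => y ^ 2 + 2 * h * y + h ^ 2) μ :=
    (hsq.add (hint.const_mul _)).add (integrable_const _)
  have hcalc : ∫ y, (y ^ 2 + 2 * h * y + h ^ 2) ∂μ = ∫ y, y ^ 2 ∂μ + h ^ 2 := by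
    rw [integral_add (f := fun y => y ^ 2 + 2 * h * y) (hsq.add (hint.const_mul _))
      (integrable_const _), integral_add hsq (hint.const_mul _), integral_const_mul, hmean]
    simp
  have hle : ∫ y, (y ^ 2 + 2 * h * y + h ^ 2
        - {y : ℝ | k ≤ |y|}.indicator (fun y => 4 * y ^ 2) y) ∂μ
      ≤ ∫ y, min ((y + h) ^ 2) (4 * k ^ 2) ∂μ := by
    refine integral_mono (hexp.sub hind) (integrable_of_measurable_of_mem_Icc (D := 4 * k ^ 2)
      (by fun_prop) (fun y => by positivity) fun y => min_le_right _ _) fun y => ?_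
    have hk0 : 0 ≤ k := (abs_nonneg h).trans hh
    obtain ⟨hh1, hh2⟩ := abs_le.1 hh
    by_cases hy : y ∈ {y : ℝ | k ≤ |y|}
    · simp only [indicator_of_mem hy]
      have h1 : h ^ 2 ≤ y ^ 2 := sq_le_sq.2 (hh.trans hy)
      refine le_min ?_ ?_ <;> nlinarith [sq_nonneg (y - h), sq_nonneg k]
    · simp only [indicator_of_notMem hy]
      obtain ⟨hy1, hy2⟩ := abs_lt.1 (not_le.1 fun h => hy (mem_ofPred.2 h))
      refine le_min (by nlinarith) ?_
      have : (y + h) ^ 2 ≤ (2 * k) ^ 2 := sq_le_sq' (by linarith) (by linarith)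
      nlinarith
  rw [integral_sub hexp hind, hcalc] at hle
  linarith

lemma hkfun_eq (k x : ℝ) :
    hkfun k x = x + Real.log (1 + Real.exp (-(k + x))) - Real.log (1 + Real.exp (-(k - x))) := by
  have h1 : Real.exp (-k) + Real.exp x = Real.exp x * (1 + Real.exp (-(k + x))) := by
    rw [mul_add, ← Real.exp_add]; ring_nf
  rw [hkfun, h1, Real.log_div (by positivity) (by positivity),
    Real.log_mul (by positivity) (by positivity), Real.log_exp, neg_sub]

lemma abs_hkfun_le {k : ℝ} (hk : 0 ≤ k) (x : ℝ) : |hkfun k x| ≤ k := by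
  have hd : 0 < 1 + Real.exp (x - k) := by positivity
  rw [hkfun, abs_le]
  constructor
  · rw [Real.le_log_iff_exp_le (by positivity), le_div_iff₀ hd, mul_add, ← Real.exp_add, mul_one]
    gcongr; linarith
  · rw [Real.log_le_iff_le_exp (by positivity), div_le_iff₀ hd, mul_add, ← Real.exp_add, mul_one]
    have h1 : k + (x - k) = x := by ring
    rw [h1]
    gcongr; linarith

lemma log_one_add_exp_mem (t : ℝ) :
    0 ≤ Real.log (1 + Real.exp t) ∧ Real.log (1 + Real.exp t) ≤ Real.exp t := by
  have := Real.exp_pos t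
  refine ⟨Real.log_nonneg (by linarith), ?_⟩
  have := Real.log_le_sub_one_of_pos (x := 1 + Real.exp t) (by positivity)
  linarith

lemma sq_sub_hkfun_sq_le {k x : ℝ} (hx : |x| < k) :
    x ^ 2 - hkfun k x ^ 2 ≤ 2 * k * (Real.exp (-(k - x)) + Real.exp (-(k + x))) := by
  have hk : 0 ≤ k := (abs_nonneg x).trans hx.le
  obtain ⟨h1, h2⟩ := log_one_add_exp_mem (-(k - x))
  obtain ⟨h3, h4⟩ := log_one_add_exp_mem (-(k + x))
  have h5 : |x + hkfun k x| ≤ 2 * k := by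
    have := abs_add_le x (hkfun k x)
    have := abs_hkfun_le hk x
    linarith
  have h6 : |x - hkfun k x| ≤ Real.exp (-(k - x)) + Real.exp (-(k + x)) := by
    rw [hkfun_eq, abs_le]
    constructor <;> linarith [Real.exp_pos (-(k - x)), Real.exp_pos (-(k + x))]
  calc x ^ 2 - hkfun k x ^ 2 = (x + hkfun k x) * (x - hkfun k x) := by ring
    _ ≤ |x + hkfun k x| * |x - hkfun k x| := by rw [← abs_mul]; exact le_abs_self _
    _ ≤ _ := by gcongr

/-- A nonnegative Lyapunov function of size `O(k ^ 2)` whose expectation drops by a fixed amount at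
every step of the chain inside `(-k, k)`. -/
lemma exists_lyapunov {μ : Measure ℝ} [IsProbabilityMeasure μ]
    (hmean : ∫ y, y ∂μ = 0) (hsq : Integrable (fun y => y ^ 2) μ)
    (hr : 0 < μ (Ioi (Real.log 2))) (hl : 0 < μ (Iio (-Real.log 2))) :
    ∃ (a B k₁ : ℝ), 0 < a ∧ 0 < B ∧ ∀ k ≥ k₁, ∃ V : ℝ → ℝ≥0∞, Measurable V ∧
      (∀ x, V x ≤ ENNReal.ofReal (B * k ^ 2)) ∧
      ∀ x, |x| < k → ∫⁻ y, V (y + hkfun k x) ∂μ + ENNReal.ofReal a ≤ V x := by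
  have hl2 : 0 < Real.log 2 := Real.log_pos (by norm_num)
  have hint : Integrable (fun y => y) μ :=
    ((memLp_two_iff_integrable_sq measurable_id.aestronglyMeasurable).2 hsq).integrable
      (by norm_num)
  have hvar : 0 < ∫ y, y ^ 2 ∂μ := by
    rw [integral_pos_iff_support_of_nonneg (fun y => sq_nonneg y) hsq]
    refine hr.trans_le (measure_mono fun y hy => ?_)
    have : 0 < y := hl2.trans hy
    exact (pow_pos this 2).ne'
  set ν := μ.map (fun y => -y) with hν
  have hneg : Measurable (fun y : ℝ => -y) := measurable_neg
  have : IsProbabilityMeasure ν := Measure.isProbabilityMeasure_map hneg.aemeasurable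
  have hintν : Integrable (fun y => y) ν := by
    rw [hν, integrable_map_measure (by fun_prop) hneg.aemeasurable]
    exact hint.neg
  have hmeanν : ∫ y, y ∂ν = 0 := by
    rw [hν, integral_map hneg.aemeasurable (by fun_prop), integral_neg, hmean, neg_zero]
  have hrν : 0 < ν (Ioi (Real.log 2)) := by
    rw [hν, Measure.map_apply hneg measurableSet_Ioi]
    convert hl using 2
    ext y
    simp [lt_neg]
  obtain ⟨G, c, D, hc, hGm, hG0, hGD, hG⟩ := exists_boundary_gain hint hmean hr
  obtain ⟨H, d, E, hd, hHm, hH0, hHE, hH⟩ := exists_boundary_gain hintν hmeanν hrν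
  obtain ⟨k₁, hk₁⟩ := exists_forall_integral_min_sq_ge hint hmean hsq hvar
  have hD0 : 0 ≤ D := (hG0 0).trans (hGD 0)
  have hE0 : 0 ≤ E := (hH0 0).trans (hHE 0)
  refine ⟨(∫ y, y ^ 2 ∂μ) / 2, 4 + 2 / c * D + 2 / d * E, max k₁ 1, half_pos hvar,
    by positivity, fun k hk => ?_⟩
  have hkk₁ : k₁ ≤ k := (le_max_left _ _).trans hk
  have hk1 : 1 ≤ k := (le_max_right _ _).trans hk
  set f : ℝ → ℝ := fun x => min (x ^ 2) (4 * k ^ 2) + 2 * k / c * G (x - k)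
    + 2 * k / d * H (-x - k) with hf
  have hGmeas := hGm.measurable
  have hHmeas := hHm.measurable
  have hfm : Measurable f := by fun_prop
  set S : ℝ := (4 + 2 / c * D + 2 / d * E) * k ^ 2 with hS
  have hf0 : ∀ x, 0 ≤ f x := fun x => by
    have := hG0 (x - k)
    have := hH0 (-x - k)
    positivity
  have hfS : ∀ x, f x ≤ S := fun x => by
    have h1 := hGD (x - k)
    have h2 := hHE (-x - k)
    have h3 : min (x ^ 2) (4 * k ^ 2) ≤ 4 * k ^ 2 := min_le_right _ _
    calc f x ≤ 4 * k ^ 2 + 2 * k / c * D + 2 * k / d * E := by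
          simp only [hf]; gcongr
      _ = 4 * k ^ 2 + 2 / c * D * k + 2 / d * E * k := by ring
      _ ≤ 4 * k ^ 2 + 2 / c * D * k ^ 2 + 2 / d * E * k ^ 2 := by
          have : k ≤ k ^ 2 := by nlinarith
          gcongr
      _ = S := by rw [hS]; ring
  refine ⟨fun x => ENNReal.ofReal (S - f x), by fun_prop, fun x =>
    ENNReal.ofReal_le_ofReal (by linarith [hf0 x]), fun x hx => ?_⟩
  obtain ⟨hx1, hx2⟩ := abs_lt.1 hx
  set h := hkfun k x with hh
  have hfi : Integrable (fun y => f (y + h)) μ :=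
    integrable_of_measurable_of_mem_Icc (by fun_prop) (fun _ => hf0 _) fun _ => hfS _
  have hlint := ofReal_integral_eq_lintegral_ofReal (f := fun y => S - f (y + h))
    ((integrable_const S).sub hfi) (ae_of_all _ fun y => sub_nonneg.2 (hfS _))
  simp only
  rw [← hlint, ← ENNReal.ofReal_add (integral_nonneg fun y => sub_nonneg.2 (hfS _))
    (half_pos hvar).le]
  refine ENNReal.ofReal_le_ofReal ?_
  rw [integral_sub (integrable_const S) hfi]
  simp only [integral_const, probReal_univ, smul_eq_mul, one_mul]
  suffices hgain : f x + (∫ y, y ^ 2 ∂μ) / 2 ≤ ∫ y, f (y + h) ∂μ by linarith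
  have hi1 : Integrable (fun y => min ((y + h) ^ 2) (4 * k ^ 2)) μ :=
    integrable_of_measurable_of_mem_Icc (D := 4 * k ^ 2)
      (by fun_prop) (fun y => by positivity) fun y => min_le_right _ _
  have hi2 : Integrable (fun y => G (y + h - k)) μ :=
    integrable_of_measurable_of_mem_Icc (by fun_prop) (fun _ => hG0 _) fun _ => hGD _
  have hi3 : Integrable (fun y => H (-(y + h) - k)) μ :=
    integrable_of_measurable_of_mem_Icc (by fun_prop) (fun _ => hH0 _) fun _ => hHE _
  have hsplit : ∫ y, f (y + h) ∂μ = ∫ y, min ((y + h) ^ 2) (4 * k ^ 2) ∂μ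
      + 2 * k / c * ∫ y, G (y + h - k) ∂μ + 2 * k / d * ∫ y, H (-(y + h) - k) ∂μ := by
    simp only [hf]
    rw [integral_add (f := fun y => min ((y + h) ^ 2) (4 * k ^ 2) + 2 * k / c * G (y + h - k))
      (hi1.add (hi2.const_mul _)) (hi3.const_mul _), integral_add hi1 (hi2.const_mul _),
      integral_const_mul, integral_const_mul]
  have hquad := hk₁ k hkk₁ h (abs_hkfun_le (by linarith) x)
  have hdrift := sq_sub_hkfun_sq_le hx
  rw [← hh] at hdrift
  have hright : G (x - k) + c * Real.exp (-(k - x)) ≤ ∫ y, G (y + h - k) ∂μ := by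
    have := hG (k - x) (by linarith)
    rw [neg_sub] at this ⊢
    refine this.trans (integral_mono (integrable_of_measurable_of_mem_Icc (by fun_prop)
      (fun _ => hG0 _) fun _ => hGD _) hi2 fun y => hGm ?_)
    rw [hh, hkfun_eq, neg_sub]
    linarith [(log_one_add_exp_mem (-(k + x))).1]
  have hleft : H (-x - k) + d * Real.exp (-(k + x)) ≤ ∫ y, H (-(y + h) - k) ∂μ := by
    have := hH (k + x) (by linarith)
    rw [hν, integral_map hneg.aemeasurable
      (Measurable.aestronglyMeasurable (by fun_prop))] at this
    have he : -x - k = -(k + x) := by ring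
    rw [he]
    refine this.trans (integral_mono (integrable_of_measurable_of_mem_Icc (by fun_prop)
      (fun _ => hH0 _) fun _ => hHE _) hi3 fun y => hHm ?_)
    rw [hh, hkfun_eq]
    linarith [(log_one_add_exp_mem (-(k - x))).1]
  have hK : 0 ≤ 2 * k / c := by positivity
  have hK' : 0 ≤ 2 * k / d := by positivity
  have h1 := mul_le_mul_of_nonneg_left hright hK
  have h2 := mul_le_mul_of_nonneg_left hleft hK'
  have h3 : 2 * k / c * (c * Real.exp (-(k - x))) = 2 * k * Real.exp (-(k - x)) := by
    field_simp
  have h4 : 2 * k / d * (d * Real.exp (-(k + x))) = 2 * k * Real.exp (-(k + x)) := by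
    field_simp
  have h5 : min (x ^ 2) (4 * k ^ 2) ≤ x ^ 2 := min_le_left _ _
  rw [hsplit]
  simp only [hf]
  linarith

lemma tauK_le_tsum (k : ℝ) (zs : ℕ → ℝ) (y : ℝ) :
    tauK k zs y
      ≤ ∑' n, {n : ℕ | ∀ j ≤ n, |chainX k zs y j| < k}.indicator (fun _ => (1 : ℝ≥0∞)) n := by
  classical
  by_cases hex : ∃ n, k ≤ |chainX k zs y n|
  · have hN := Nat.find_spec hex
    calc tauK k zs y ≤ (Nat.find hex : ℝ≥0∞) := by exact iInf₂_le (Nat.find hex) hN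
      _ = ∑ n ∈ Finset.range (Nat.find hex),
          {n : ℕ | ∀ j ≤ n, |chainX k zs y j| < k}.indicator (fun _ => (1 : ℝ≥0∞)) n := by
        rw [Finset.sum_congr rfl fun n hn => indicator_of_mem ?_ _]
        · simp
        · intro j hj
          exact not_le.1 (Nat.find_min hex (hj.trans_lt (Finset.mem_range.1 hn)))
      _ ≤ _ := ENNReal.sum_le_tsum _
  · push Not at hex
    have : {n : ℕ | ∀ j ≤ n, |chainX k zs y j| < k} = univ := by
      ext n; simp [hex]
    simp [this]

lemma measurable_hkfun (k : ℝ) : Measurable (hkfun k) := by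
  unfold hkfun
  fun_prop

lemma measurable_chainX_natural {Ω : Type*} [MeasurableSpace Ω] {z : ℕ → Ω → ℝ}
    (hz : ∀ i, StronglyMeasurable (z i)) (k y : ℝ) (n : ℕ) :
    Measurable[Filtration.natural z hz n] fun ω => chainX k (fun i => z i ω) y n := by
  induction n with
  | zero => exact measurable_const
  | succ n ih =>
    have h1 : Measurable[Filtration.natural z hz (n + 1)] (z (n + 1)) :=
      ((Filtration.stronglyAdapted_natural hz) (n + 1)).measurable
    have h2 := ih.mono ((Filtration.natural z hz).mono n.le_succ) le_rfl
    exact h1.add ((measurable_hkfun k).comp h2)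

lemma measurableSet_forall_abs_chainX_lt {Ω : Type*} [MeasurableSpace Ω] {z : ℕ → Ω → ℝ}
    (hz : ∀ i, StronglyMeasurable (z i)) (k y : ℝ) (n : ℕ) :
    MeasurableSet[Filtration.natural z hz n]
      {ω | ∀ j ≤ n, |chainX k (fun i => z i ω) y j| < k} := by
  simp only [ofPred_forall]
  refine MeasurableSet.iInter fun j => MeasurableSet.iInter fun hj => ?_
  have h := (measurable_chainX_natural hz k y j).mono ((Filtration.natural z hz).mono hj) le_rfl
  exact h (measurableSet_lt (f := fun x : ℝ => |x|) (by fun_prop) measurable_const)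

/-- One step of the chain killed on leaving `(-k, k)`. -/
lemma lintegral_survival_step {Ω : Type*} [MeasurableSpace Ω] {P : Measure Ω}
    [IsProbabilityMeasure P] {z : ℕ → Ω → ℝ} (hz : ∀ i, Measurable (z i)) (hindep : iIndepFun z P)
    {μ : Measure ℝ} (hlaw : ∀ i, P.map (z i) = μ) {k : ℝ} {V : ℝ → ℝ≥0∞} (hV : Measurable V)
    {a : ℝ≥0∞} (hdec : ∀ x, |x| < k → ∫⁻ t, V (t + hkfun k x) ∂μ + a ≤ V x) (y : ℝ) (n : ℕ) :
    ∫⁻ ω in {ω | ∀ j ≤ n + 1, |chainX k (fun i => z i ω) y j| < k},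
        V (chainX k (fun i => z i ω) y (n + 1)) ∂P
      + a * P {ω | ∀ j ≤ n, |chainX k (fun i => z i ω) y j| < k}
      ≤ ∫⁻ ω in {ω | ∀ j ≤ n, |chainX k (fun i => z i ω) y j| < k},
        V (chainX k (fun i => z i ω) y n) ∂P := by
  classical
  have hzs : ∀ i, StronglyMeasurable (z i) := fun i => (hz i).stronglyMeasurable
  set S := {ω | ∀ j ≤ n, |chainX k (fun i => z i ω) y j| < k}
  set X : Ω → ℝ := fun ω => chainX k (fun i => z i ω) y n
  have hμ : IsProbabilityMeasure μ := hlaw 0 ▸ Measure.isProbabilityMeasure_map (hz 0).aemeasurable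
  have hSn : MeasurableSet[Filtration.natural z hzs n] S :=
    measurableSet_forall_abs_chainX_lt hzs k y n
  have hSm : MeasurableSet S := (Filtration.natural z hzs).le n _ hSn
  have hXn : Measurable[Filtration.natural z hzs n] X := measurable_chainX_natural hzs k y n
  set W : Ω → ℝ := S.piecewise X (fun _ => k) with hW
  have hWn : Measurable[Filtration.natural z hzs n] W :=
    Measurable.piecewise hSn hXn measurable_const
  have hWm : Measurable W := hWn.mono ((Filtration.natural z hzs).le n) le_rfl
  have hind : IndepFun W (z (n + 1)) P := by
    rw [IndepFun_iff_Indep]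
    exact indep_of_indep_of_le_left
      (hindep.indep_comap_natural_of_lt hzs n.lt_succ_self).symm hWn.comap_le
  have hprod := (indepFun_iff_map_prod_eq_prod_map_map hWm.aemeasurable
    (hz (n + 1)).aemeasurable).1 hind
  rw [hlaw] at hprod
  have hA : MeasurableSet {x : ℝ | |x| < k} :=
    measurableSet_lt (f := fun x : ℝ => |x|) (by fun_prop) measurable_const
  have hΦ : Measurable fun p : ℝ × ℝ =>
      {x : ℝ | |x| < k}.indicator (fun x => V (p.2 + hkfun k x)) p.1 := by
    have : (fun p : ℝ × ℝ => {x : ℝ | |x| < k}.indicator (fun x => V (p.2 + hkfun k x)) p.1)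
        = (Prod.fst ⁻¹' {x : ℝ | |x| < k}).indicator (fun p => V (p.2 + hkfun k p.1)) := by
      ext p; simp [indicator]
    rw [this]
    exact (hV.comp (measurable_snd.add ((measurable_hkfun k).comp measurable_fst))).indicator
      (measurable_fst hA)
  have hWS : ∀ ω, |W ω| < k ↔ ω ∈ S := fun ω => by
    by_cases hω : ω ∈ S
    · simp only [hW, piecewise_eq_of_mem _ _ _ hω, hω, iff_true]
      exact hω n le_rfl
    · simp only [hW, piecewise_eq_of_notMem _ _ _ hω, hω, iff_false, not_lt]
      exact le_abs_self k
  have hWA : ∀ ω, W ω ∈ {x : ℝ | |x| < k} ↔ ω ∈ S := fun ω => mem_ofPred.trans (hWS ω)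
  have hWX : ∀ ω ∈ S, W ω = X ω := fun ω hω => piecewise_eq_of_mem _ _ _ hω
  have hsub : {ω | ∀ j ≤ n + 1, |chainX k (fun i => z i ω) y j| < k} ⊆ S := fun ω hω =>
    mem_ofPred.2 fun j hj => mem_ofPred.1 hω j (hj.trans n.le_succ)
  calc _ ≤ ∫⁻ ω in S, V (z (n + 1) ω + hkfun k (X ω)) ∂P + a * P S := by
        exact add_le_add (lintegral_mono_set hsub) le_rfl
    _ = ∫⁻ ω, {x : ℝ | |x| < k}.indicator (fun x => V (z (n + 1) ω + hkfun k x)) (W ω) ∂P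
          + a * P S := by
        rw [← lintegral_indicator hSm]
        congr 2
        ext ω
        by_cases hω : ω ∈ S
        · rw [indicator_of_mem hω, indicator_of_mem ((hWA ω).2 hω), hWX ω hω]
        · rw [indicator_of_notMem hω, indicator_of_notMem (fun h => hω ((hWA ω).1 h))]
    _ = ∫⁻ ω, (∫⁻ t, {x : ℝ | |x| < k}.indicator (fun x => V (t + hkfun k x)) (W ω) ∂μ) ∂P
          + ∫⁻ ω, S.indicator (fun _ => a) ω ∂P := by
        rw [lintegral_indicator_const hSm]
        congr 1
        rw [← lintegral_map (f := fun p : ℝ × ℝ =>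
            {x : ℝ | |x| < k}.indicator (fun x => V (p.2 + hkfun k x)) p.1) hΦ
            (hWm.prodMk (hz (n + 1))), hprod, lintegral_prod _ hΦ.aemeasurable,
          lintegral_map hΦ.lintegral_prod_right' hWm]
    _ = ∫⁻ ω, ((∫⁻ t, {x : ℝ | |x| < k}.indicator (fun x => V (t + hkfun k x)) (W ω) ∂μ)
          + S.indicator (fun _ => a) ω) ∂P := by
        rw [lintegral_add_right _ (measurable_const.indicator hSm)]
    _ ≤ ∫⁻ ω, S.indicator (fun ω => V (X ω)) ω ∂P := by
        refine lintegral_mono fun ω => ?_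
        by_cases hω : ω ∈ S
        · have hXA : X ω ∈ {x : ℝ | |x| < k} := hWX ω hω ▸ (hWA ω).2 hω
          simp only [hWX ω hω, indicator_of_mem hω, indicator_of_mem hXA]
          exact hdec _ hXA
        · have hω' : W ω ∉ {x : ℝ | |x| < k} := fun h => hω ((hWA ω).1 h)
          simp only [indicator_of_notMem hω, indicator_of_notMem hω']
          simp
    _ = _ := lintegral_indicator hSm _

lemma mul_lintegral_tauK_le {Ω : Type*} [MeasurableSpace Ω] {P : Measure Ω}
    [IsProbabilityMeasure P] {z : ℕ → Ω → ℝ} (hz : ∀ i, Measurable (z i)) (hindep : iIndepFun z P)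
    {μ : Measure ℝ} (hlaw : ∀ i, P.map (z i) = μ) {k : ℝ} {V : ℝ → ℝ≥0∞} (hV : Measurable V)
    {a : ℝ≥0∞} (hdec : ∀ x, |x| < k → ∫⁻ t, V (t + hkfun k x) ∂μ + a ≤ V x) (y : ℝ) :
    a * ∫⁻ ω, tauK k (fun i => z i ω) y ∂P ≤ V y := by
  have hzs : ∀ i, StronglyMeasurable (z i) := fun i => (hz i).stronglyMeasurable
  set S : ℕ → Set Ω := fun n => {ω | ∀ j ≤ n, |chainX k (fun i => z i ω) y j| < k}
  have hSm : ∀ n, MeasurableSet (S n) := fun n =>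
    (Filtration.natural z hzs).le n _ (measurableSet_forall_abs_chainX_lt hzs k y n)
  have hsum : ∀ N, ∫⁻ ω in S N, V (chainX k (fun i => z i ω) y N) ∂P
      + a * ∑ n ∈ Finset.range N, P (S n) ≤ V y := by
    intro N
    induction N with
    | zero =>
      simp only [Finset.range_zero, Finset.sum_empty, mul_zero, add_zero, chainX,
        setLIntegral_const]
      exact mul_le_of_le_one_right' prob_le_one
    | succ N ih =>
      refine le_trans ?_ ih
      rw [Finset.sum_range_succ, mul_add, add_comm (a * _), ← add_assoc]
      gcongr
      exact lintegral_survival_step hz hindep hlaw hV hdec y N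
  calc a * ∫⁻ ω, tauK k (fun i => z i ω) y ∂P
      ≤ a * ∫⁻ ω, ∑' n, (S n).indicator (fun _ => (1 : ℝ≥0∞)) ω ∂P := by
        gcongr with ω
        exact tauK_le_tsum k _ y
    _ = a * ∑' n, P (S n) := by
        rw [lintegral_tsum fun n => (measurable_const.indicator (hSm n)).aemeasurable]
        congr 2
        ext n
        rw [lintegral_indicator_const (hSm n), one_mul]
    _ ≤ V y := by
        rw [← ENNReal.tsum_mul_left]
        refine ENNReal.tsum_le_of_sum_range_le fun N => ?_
        rw [← Finset.mul_sum]
        exact le_add_self.trans (hsum N)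

lemma integrable_sq_of_exp_tail {Ω : Type*} [MeasurableSpace Ω] {P : Measure Ω} {X : Ω → ℝ}
    (hX : Measurable X) {δ C : ℝ} (hδ : 0 < δ)
    (htail : ∀ x : ℝ, 0 ≤ x → P {ω | x < |X ω|} ≤ ENNReal.ofReal (C * Real.exp (-δ * x))) :
    Integrable (fun ω => X ω ^ 2) P := by
  refine ⟨by fun_prop, ?_⟩
  have hlay := lintegral_rpow_eq_lintegral_meas_lt_mul P (f := fun ω => |X ω|)
    (ae_of_all _ fun ω => abs_nonneg _) (by fun_prop) (p := 2) (by norm_num)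
  have hint : IntegrableOn (fun t : ℝ => C * (t ^ (1 : ℝ) * Real.exp (-δ * t ^ (1 : ℝ)))) (Ioi 0) :=
    (integrableOn_rpow_mul_exp_neg_mul_rpow (by norm_num) (by norm_num) hδ).const_mul C
  have hfin : ∫⁻ t in Ioi (0 : ℝ), P {ω | t < |X ω|} * ENNReal.ofReal (t ^ ((2 : ℝ) - 1)) < ⊤ := by
    refine lt_of_le_of_lt (setLIntegral_mono' measurableSet_Ioi fun t ht => ?_)
      hint.integrable.lintegral_lt_top
    have ht0 : (0 : ℝ) ≤ t := le_of_lt ht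
    refine (mul_le_mul_left (htail t ht0) _).trans ?_
    rw [← ENNReal.ofReal_mul' (by positivity)]
    refine ENNReal.ofReal_le_ofReal (le_of_eq ?_)
    norm_num
    ring
  rw [hasFiniteIntegral_iff_ofReal (ae_of_all _ fun ω => sq_nonneg _)]
  have heq : ∫⁻ ω, ENNReal.ofReal (X ω ^ 2) ∂P = ∫⁻ ω, ENNReal.ofReal (|X ω| ^ (2 : ℝ)) ∂P := by
    simp
  rw [heq, hlay]
  exact ENNReal.mul_lt_top ENNReal.ofReal_lt_top hfin

/-- Lemma: bound on the expected exit time from (-k, k). -/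
theorem stmt16
    {Ω : Type*} [MeasurableSpace Ω] (P : Measure Ω) [IsProbabilityMeasure P]
    (z : ℕ → Ω → ℝ) (hzmeas : ∀ i, Measurable (z i))
    (hindep : iIndepFun z P)
    (ζ : ℝ → ℝ) (hζmeas : Measurable ζ) (hζnn : ∀ x, 0 ≤ ζ x)
    (hlaw : ∀ i, Measure.map (z i) P = volume.withDensity (fun x => ENNReal.ofReal (ζ x)))
    (hmean : ∫ ω, z 0 ω ∂P = 0)
    (δ : ℝ) (hδ : 0 < δ) (Cδ : ℝ)
    (htail : ∀ x : ℝ, 0 ≤ x → P {ω | x < |z 0 ω|} ≤ ENNReal.ofReal (Cδ * Real.exp (-δ * x)))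
    (θ : ℝ) (hθ0 : 0 < θ) (hθ1 : θ ≤ 1) (Cθ : ℝ)
    (hHolder : ∀ x y : ℝ, |ζ x - ζ y| ≤ Cθ * |x - y| ^ θ)
    (h2r : 0 < P {ω | Real.log 2 < z 0 ω}) (h2l : 0 < P {ω | z 0 ω < -Real.log 2}) :
    ∃ C : ℝ, 0 < C ∧ ∃ k₀ : ℝ, 0 < k₀ ∧ ∀ k ≥ k₀,
      (⨆ x : ℝ, ∫⁻ ω, tauK k (fun i => z i ω) x ∂P)
        ≤ ENNReal.ofReal (1 / 2 * k ^ 2 * Real.log k ^ C) := by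
  set μ := volume.withDensity (fun x => ENNReal.ofReal (ζ x)) with hμ
  have hprob : IsProbabilityMeasure μ :=
    hlaw 0 ▸ Measure.isProbabilityMeasure_map (hzmeas 0).aemeasurable
  have hmean' : ∫ y, y ∂μ = 0 := by
    rw [← hlaw 0, integral_map (hzmeas 0).aemeasurable (by fun_prop), hmean]
  have hsq : Integrable (fun y => y ^ 2) μ := by
    rw [← hlaw 0, integrable_map_measure (by fun_prop) (hzmeas 0).aemeasurable]
    exact integrable_sq_of_exp_tail (hzmeas 0) hδ htail
  have hr : 0 < μ (Ioi (Real.log 2)) := by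
    rwa [← hlaw 0, Measure.map_apply (hzmeas 0) measurableSet_Ioi]
  have hl : 0 < μ (Iio (-Real.log 2)) := by
    rwa [← hlaw 0, Measure.map_apply (hzmeas 0) measurableSet_Iio]
  obtain ⟨a, B, k₁, ha, hB, hV⟩ := exists_lyapunov hmean' hsq hr hl
  refine ⟨1, one_pos, max k₁ (Real.exp (2 * (B / a))), by positivity, fun k hk => iSup_le fun x => ?_⟩
  obtain ⟨V, hVm, hVB, hVdec⟩ := hV k ((le_max_left _ _).trans hk)
  have hk2 : Real.exp (2 * (B / a)) ≤ k := (le_max_right _ _).trans hk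
  have hk0 : 0 < k := (Real.exp_pos _).trans_le hk2
  have hlog : 2 * (B / a) ≤ Real.log k := (Real.le_log_iff_exp_le hk0).2 hk2
  have hmain := (mul_lintegral_tauK_le hzmeas hindep hlaw hVm hVdec x).trans (hVB x)
  rw [mul_comm, ← ENNReal.le_div_iff_mul_le (Or.inl (by simpa using ha))
    (Or.inl ENNReal.ofReal_ne_top), ← ENNReal.ofReal_div_of_pos ha] at hmain
  refine hmain.trans (ENNReal.ofReal_le_ofReal ?_)
  rw [Real.rpow_one]
  calc B * k ^ 2 / a = 1 / 2 * k ^ 2 * (2 * (B / a)) := by ring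
    _ ≤ _ := by gcongr
end

section
/- Let f : ℝ → ℝ satisfy |f(x) − f(y)| ≤ |x − y|^θ for all x ≠ y (for some θ > 0) and ∫_ℝ |f(x)| e^{c|x|} dx < ∞ for some c > 0. Then the Fourier transform f̂(t) := ∫_ℝ f(x) e^{itx} dx satisfies ∫_ℝ |f̂(t)| / (1 + |t|)^{1/2} dt < ∞. -/
open MeasureTheory Real
open scoped ENNReal

open scoped FourierTransform SchwartzMap ContDiff

/-- The Fourier transform of an integrable function is continuous. -/
theorem continuous_fourier_of_integrable {g : ℝ → ℂ} (hg : Integrable g) : Continuous (𝓕 g) :=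
  VectorFourier.fourierIntegral_continuous Real.continuous_fourierChar
    (innerSL ℝ).continuous₂ hg

/-- On `L¹ ∩ L²` the `L²` Fourier transform is given by the Fourier integral. -/
theorem fourier_toLp_ae_eq {g : ℝ → ℂ} (hg : Integrable g) (hg2 : MemLp g 2) :
    (𝓕 (hg2.toLp g) : Lp ℂ 2 (volume : Measure ℝ)) =ᵐ[volume] 𝓕 g := by
  refine ae_eq_of_integral_contDiff_smul_eq
    ((Lp.memLp _).locallyIntegrable (by norm_num))
    (continuous_fourier_of_integrable hg).locallyIntegrable ?_
  intro φ hφ hφc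
  have hc : HasCompactSupport (Complex.ofRealCLM ∘ φ) := hφc.comp_left rfl
  have hs : ContDiff ℝ ∞ (Complex.ofRealCLM ∘ φ) := by fun_prop
  set ψ : 𝓢(ℝ, ℂ) := hc.toSchwartzMap hs with hψ
  have hψφ : ∀ x, ψ x = (φ x : ℂ) := fun x => by simp [hψ]
  have key := congrArg (fun T : 𝓢'(ℝ, ℂ) => T ψ)
    (Lp.fourier_toTemperedDistribution_eq (hg2.toLp g))
  simp only [TemperedDistribution.fourier_apply, Lp.toTemperedDistribution_apply] at key
  have h1 : ∫ x, (𝓕 ψ) x • (hg2.toLp g : ℝ → ℂ) x = ∫ x, 𝓕 (ψ : ℝ → ℂ) x • g x := by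
    refine integral_congr_ae ?_
    filter_upwards [hg2.coeFn_toLp] with x hx
    rw [hx, SchwartzMap.fourier_coe]
  have h2 : ∫ x, 𝓕 (ψ : ℝ → ℂ) x • g x = ∫ x, ψ x • 𝓕 g x := by
    have := VectorFourier.integral_fourierIntegral_smul_eq_flip (L := innerₗ ℝ)
      (μ := volume) (ν := volume)
      Real.continuous_fourierChar (innerSL ℝ).continuous₂ ψ.integrable hg
    rwa [flip_innerₗ] at this
  rw [h1, h2] at key
  simp only [hψφ, smul_eq_mul] at key
  simpa only [Complex.real_smul] using key.symm

/-- Plancherel's theorem for functions in `L¹ ∩ L²`. -/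
theorem lintegral_enorm_fourier_sq {g : ℝ → ℂ} (hg : Integrable g) (hg2 : MemLp g 2) :
    ∫⁻ w, ‖𝓕 g w‖ₑ ^ 2 = ∫⁻ x, ‖g x‖ₑ ^ 2 := by
  have h : eLpNorm (𝓕 g) 2 volume = eLpNorm g 2 volume := by
    rw [← eLpNorm_congr_ae (fourier_toLp_ae_eq hg hg2), ← eLpNorm_congr_ae hg2.coeFn_toLp,
      ← Lp.enorm_def, ← Lp.enorm_def, ← ofReal_norm, ← ofReal_norm, Lp.norm_fourier_eq]
  simp only [eLpNorm_eq_lintegral_rpow_enorm_toReal two_ne_zero ENNReal.ofNat_ne_top] at h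
  have h' := ENNReal.rpow_left_injective (by norm_num) h
  simpa using h'

/-- The Fourier transform of the increment `x ↦ g (x + h) - g x`. -/
theorem fourier_increment {g : ℝ → ℂ} (hg : Integrable g) (h w : ℝ) :
    𝓕 (fun x => g (x + h) - g x) w = (𝐞 (h * w) - 1 : ℂ) * 𝓕 g w := by
  have hT : 𝓕 (fun x => g (x + h)) w = (𝐞 (h * w) : ℂ) * 𝓕 g w := by
    have := congrFun (VectorFourier.fourierIntegral_comp_add_right 𝐞 volume (innerₗ ℝ) g h) w
    rw [mul_comm h w]
    exact this
  rw [sub_mul, one_mul, ← hT]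
  simp only [Real.fourier_eq, smul_sub]
  exact integral_sub ((Real.fourierIntegral_convergent_iff w).2 (hg.comp_add_right h))
    ((Real.fourierIntegral_convergent_iff w).2 hg)

/-- A quarter-to-half turn of the circle moves the point `1` by at least `1`. -/
theorem one_le_norm_fourierChar_sub_one {s : ℝ} (h1 : 1 / 4 ≤ |s|) (h2 : |s| ≤ 1 / 2) :
    1 ≤ ‖(𝐞 s - 1 : ℂ)‖ := by
  have hre : (𝐞 s - 1 : ℂ).re = Real.cos (2 * π * |s|) - 1 := by
    have : Real.cos (2 * π * |s|) = Real.cos (2 * π * s) := by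
      rw [← Real.cos_abs (2 * π * s), abs_mul, abs_of_pos Real.two_pi_pos]
    rw [this, Real.fourierChar_apply, Complex.sub_re, Complex.one_re, Complex.exp_ofReal_mul_I_re]
  have hcos : Real.cos (2 * π * |s|) ≤ 0 :=
    Real.cos_nonpos_of_pi_div_two_le_of_le (by nlinarith [Real.pi_pos]) (by nlinarith [Real.pi_pos])
  refine le_trans ?_ (Complex.abs_re_le_norm _)
  rw [hre, abs_of_nonpos (by linarith)]
  linarith

/-- The `L²` modulus of continuity of an integrable Hölder function. -/
theorem lintegral_increment_sq_le {g : ℝ → ℂ} {θ : ℝ} (hg : Integrable g) {h : ℝ}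
    (hH : ∀ x, ‖g (x + h) - g x‖ ≤ h ^ θ) :
    ∫⁻ x, ‖g (x + h) - g x‖ₑ ^ 2 ≤ ENNReal.ofReal (h ^ θ) * (2 * ∫⁻ x, ‖g x‖ₑ) := by
  have hm : AEMeasurable (fun x => ‖g (x + h)‖ₑ) :=
    (hg.comp_add_right h).aestronglyMeasurable.enorm
  calc ∫⁻ x, ‖g (x + h) - g x‖ₑ ^ 2
      ≤ ∫⁻ x, ENNReal.ofReal (h ^ θ) * (‖g (x + h)‖ₑ + ‖g x‖ₑ) := by
        refine lintegral_mono fun x => ?_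
        rw [sq]
        refine mul_le_mul' ?_ (enorm_sub_le)
        rw [← ofReal_norm]
        exact ENNReal.ofReal_le_ofReal (hH x)
    _ = ENNReal.ofReal (h ^ θ) * (2 * ∫⁻ x, ‖g x‖ₑ) := by
        rw [lintegral_const_mul' _ _ ENNReal.ofReal_ne_top, lintegral_add_left' hm,
          lintegral_add_right_eq_self (fun x => ‖g x‖ₑ) h, two_mul]

/-- The Fourier transform of an increment of an integrable Hölder function is small in `L²`. -/
theorem lintegral_fourier_increment_sq_le {g : ℝ → ℂ} {θ : ℝ} (hg : Integrable g) {h : ℝ}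
    (hH : ∀ x, ‖g (x + h) - g x‖ ≤ h ^ θ) :
    ∫⁻ w, ‖𝓕 (fun x => g (x + h) - g x) w‖ₑ ^ 2
      ≤ ENNReal.ofReal (h ^ θ) * (2 * ∫⁻ x, ‖g x‖ₑ) := by
  have hi : Integrable (fun x => g (x + h) - g x) := (hg.comp_add_right h).sub hg
  have hle := lintegral_increment_sq_le hg hH
  have h2 : MemLp (fun x => g (x + h) - g x) 2 := by
    refine ⟨hi.aestronglyMeasurable, ?_⟩
    rw [eLpNorm_lt_top_iff_lintegral_rpow_enorm_lt_top two_ne_zero ENNReal.ofNat_ne_top]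
    have hfin : ENNReal.ofReal (h ^ θ) * (2 * ∫⁻ x, ‖g x‖ₑ) < ⊤ :=
      ENNReal.mul_lt_top ENNReal.ofReal_lt_top
        (ENNReal.mul_lt_top ENNReal.ofNat_lt_top hg.hasFiniteIntegral)
    simpa using hle.trans_lt hfin
  rw [lintegral_enorm_fourier_sq hi h2]
  exact hle

/-- The dyadic square function of the Fourier transforms of increments is integrable. -/
theorem lintegral_tsum_fourier_increment_lt_top {g : ℝ → ℂ} {θ : ℝ} (hθ : 0 < θ)
    (hg : Integrable g) (hH : ∀ h, 0 < h → ∀ x, ‖g (x + h) - g x‖ ≤ h ^ θ) :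
    ∫⁻ w, ∑' n : ℕ, ENNReal.ofReal (((2 : ℝ) ^ n) ^ (θ / 2)) *
      ‖𝓕 (fun x => g (x + ((2 : ℝ) ^ n)⁻¹ / 4) - g x) w‖ₑ ^ 2 < ⊤ := by
  have hpos : ∀ n : ℕ, 0 < ((2 : ℝ) ^ n)⁻¹ / 4 := fun n => by positivity
  have hmeas : ∀ h : ℝ, Measurable fun w => ‖𝓕 (fun x => g (x + h) - g x) w‖ₑ ^ 2 := fun h =>
    ((continuous_fourier_of_integrable ((hg.comp_add_right h).sub hg)).enorm.measurable).pow_const 2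
  rw [lintegral_tsum fun n => ((hmeas _).const_mul _).aemeasurable]
  have hr0 : (0 : ℝ) ≤ (2 : ℝ) ^ (-(θ / 2)) := by positivity
  have hr1 : (2 : ℝ) ^ (-(θ / 2)) < 1 := Real.rpow_lt_one_of_one_lt_of_neg one_lt_two (by linarith)
  have hterm : ∀ n : ℕ, ∫⁻ w, ENNReal.ofReal (((2 : ℝ) ^ n) ^ (θ / 2)) *
      ‖𝓕 (fun x => g (x + ((2 : ℝ) ^ n)⁻¹ / 4) - g x) w‖ₑ ^ 2
      ≤ ENNReal.ofReal (((2 : ℝ) ^ (-(θ / 2))) ^ n) * (2 * ∫⁻ x, ‖g x‖ₑ) := by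
    intro n
    rw [lintegral_const_mul' _ _ ENNReal.ofReal_ne_top]
    refine (mul_le_mul_right
      (lintegral_fourier_increment_sq_le hg (hH _ (hpos n))) _).trans ?_
    rw [← mul_assoc, ← ENNReal.ofReal_mul (by positivity)]
    refine mul_le_mul_left (ENNReal.ofReal_le_ofReal ?_) _
    calc ((2 : ℝ) ^ n) ^ (θ / 2) * (((2 : ℝ) ^ n)⁻¹ / 4) ^ θ
        ≤ ((2 : ℝ) ^ n) ^ (θ / 2) * (((2 : ℝ) ^ n)⁻¹) ^ θ := by
          gcongr
          exact div_le_self (by positivity) (by norm_num)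
      _ = ((2 : ℝ) ^ (-(θ / 2))) ^ n := by
          rw [Real.inv_rpow (by positivity), ← Real.rpow_neg (by positivity),
            ← Real.rpow_add (by positivity), ← Real.rpow_natCast_mul two_pos.le,
            ← Real.rpow_mul_natCast two_pos.le]
          ring_nf
  refine (ENNReal.tsum_le_tsum hterm).trans_lt ?_
  rw [ENNReal.tsum_mul_right]
  refine ENNReal.mul_lt_top ?_ (ENNReal.mul_lt_top ENNReal.ofNat_lt_top hg.hasFiniteIntegral)
  rw [← ENNReal.ofReal_tsum_of_nonneg (fun n => by positivity)
    (summable_geometric_of_lt_one hr0 hr1)]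
  exact ENNReal.ofReal_lt_top

/-- The weighted square of the Fourier transform is dominated, away from the origin, by its dyadic
square function. -/
theorem weighted_fourier_sq_le_tsum {g : ℝ → ℂ} {θ : ℝ} (hθ : 0 < θ) (hg : Integrable g) {w : ℝ}
    (hw : 1 ≤ |w|) :
    ENNReal.ofReal ((1 + |w|) ^ (θ / 2) * ‖𝓕 g w‖ ^ 2) ≤ ENNReal.ofReal (4 ^ (θ / 2)) *
      ∑' n : ℕ, ENNReal.ofReal (((2 : ℝ) ^ n) ^ (θ / 2)) *
        ‖𝓕 (fun x => g (x + ((2 : ℝ) ^ n)⁻¹ / 4) - g x) w‖ₑ ^ 2 := by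
  obtain ⟨n, hn1, hn2⟩ := exists_nat_pow_near hw one_lt_two
  have hp : (0 : ℝ) < 2 ^ n := by positivity
  have habs : |((2 : ℝ) ^ n)⁻¹ / 4 * w| = |w| / 2 ^ n / 4 := by
    rw [abs_mul, abs_of_pos (by positivity)]
    ring
  have hs1 : 1 ≤ |w| / 2 ^ n := (one_le_div hp).2 hn1
  have hs2 : |w| / 2 ^ n ≤ 2 := by
    rw [div_le_iff₀ hp]
    rw [pow_succ] at hn2
    linarith
  have hone := one_le_norm_fourierChar_sub_one (s := ((2 : ℝ) ^ n)⁻¹ / 4 * w)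
    (by rw [habs]; linarith) (by rw [habs]; linarith)
  have hG : ‖𝓕 g w‖ ≤ ‖𝓕 (fun x => g (x + ((2 : ℝ) ^ n)⁻¹ / 4) - g x) w‖ := by
    rw [fourier_increment hg, norm_mul]
    exact le_mul_of_one_le_left (norm_nonneg _) hone
  refine le_trans ?_ (mul_le_mul_right (ENNReal.le_tsum n) _)
  rw [← ofReal_norm, ← ENNReal.ofReal_pow (norm_nonneg _), ← ENNReal.ofReal_mul (by positivity),
    ← ENNReal.ofReal_mul (by positivity), ← mul_assoc,
    ← Real.mul_rpow (by norm_num) hp.le]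
  refine ENNReal.ofReal_le_ofReal ?_
  rw [pow_succ] at hn2
  gcongr
  linarith

/-- The Fourier transform of an integrable Hölder function is integrable against
`(1 + |w|) ^ (-1 / 2)`. -/
theorem integrable_fourier_div_of_holder {g : ℝ → ℂ} {θ : ℝ} (hθ : 0 < θ)
    (hg : Integrable g) (hH : ∀ h, 0 < h → ∀ x, ‖g (x + h) - g x‖ ≤ h ^ θ) :
    Integrable fun w => ‖𝓕 g w‖ / (1 + |w|) ^ (1 / 2 : ℝ) := by
  have hcont := continuous_fourier_of_integrable hg
  have hden : ∀ w : ℝ, 0 < (1 + |w|) ^ (1 / 2 : ℝ) := fun w => by positivity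
  refine ⟨(hcont.norm.div (Continuous.rpow_const (by fun_prop) fun w => Or.inr (by norm_num))
    fun w => (hden w).ne').aestronglyMeasurable, ?_⟩
  set Φ : ℝ → ℝ≥0∞ := fun w => ENNReal.ofReal (4 ^ (θ / 2)) *
      ∑' n : ℕ, ENNReal.ofReal (((2 : ℝ) ^ n) ^ (θ / 2)) *
        ‖𝓕 (fun x => g (x + ((2 : ℝ) ^ n)⁻¹ / 4) - g x) w‖ₑ ^ 2 with hΦ
  set B : ℝ := ∫ x, ‖g x‖
  set A : ℝ → ℝ≥0∞ := fun w => ENNReal.ofReal ((1 + ‖w‖) ^ (-(1 + θ / 2)))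
  set I : ℝ → ℝ≥0∞ := (Set.Icc (-1) 1).indicator fun _ => ENNReal.ofReal B
  have hAm : Measurable A := by fun_prop
  have hIm : Measurable I := measurable_const.indicator measurableSet_Icc
  have hA : ∫⁻ w, A w < ⊤ :=
    finite_integral_one_add_norm (by simpa using by linarith)
  have hI : ∫⁻ w, I w < ⊤ := by
    rw [lintegral_indicator_const measurableSet_Icc]
    exact ENNReal.mul_lt_top ENNReal.ofReal_lt_top (by simp)
  have hΦi : ∫⁻ w, Φ w < ⊤ := by
    rw [hΦ, lintegral_const_mul' _ _ ENNReal.ofReal_ne_top]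
    exact ENNReal.mul_lt_top ENNReal.ofReal_lt_top
      (lintegral_tsum_fourier_increment_lt_top hθ hg hH)
  have hbound : ∀ w, ‖‖𝓕 g w‖ / (1 + |w|) ^ (1 / 2 : ℝ)‖ₑ ≤ A w + (I w + Φ w) := by
    intro w
    rw [Real.enorm_of_nonneg (by positivity)]
    rcases le_total |w| 1 with hw | hw
    · have : I w = ENNReal.ofReal B := Set.indicator_of_mem (Set.mem_Icc.2 (abs_le.1 hw)) _
      rw [this]
      refine le_trans (ENNReal.ofReal_le_ofReal ?_) (le_self_add.trans le_add_self)
      refine (div_le_self (norm_nonneg _) (Real.one_le_rpow (by simp) (by norm_num))).trans ?_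
      exact VectorFourier.norm_fourierIntegral_le_integral_norm _ _ _ _ _
    · refine le_trans ?_ (add_le_add_right
        ((weighted_fourier_sq_le_tsum hθ hg hw).trans le_add_self) _)
      rw [← ENNReal.ofReal_add (by positivity) (by positivity)]
      refine ENNReal.ofReal_le_ofReal ?_
      rw [Real.norm_eq_abs]
      have hu : 0 < 1 + |w| := by positivity
      set u := 1 + |w|
      set N := ‖𝓕 g w‖
      have e1 : u ^ (-(1 + θ / 2)) = (u ^ (-(1 / 2 + θ / 4))) ^ 2 := by
        rw [← Real.rpow_mul_natCast hu.le]
        congr 1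
        push_cast
        ring
      have e2 : u ^ (θ / 2) = (u ^ (θ / 4)) ^ 2 := by
        rw [← Real.rpow_mul_natCast hu.le]
        congr 1
        push_cast
        ring
      have e3 : N / u ^ (1 / 2 : ℝ) = u ^ (-(1 / 2 + θ / 4)) * (u ^ (θ / 4) * N) := by
        rw [← mul_assoc, ← Real.rpow_add hu, div_eq_mul_inv, ← Real.rpow_neg hu.le, mul_comm]
        ring_nf
      rw [e1, e2, e3, ← mul_pow]
      nlinarith [sq_nonneg (u ^ (-(1 / 2 + θ / 4)) - u ^ (θ / 4) * N),
        sq_nonneg (u ^ (-(1 / 2 + θ / 4))), sq_nonneg (u ^ (θ / 4) * N)]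
  refine (lintegral_mono hbound).trans_lt ?_
  rw [lintegral_add_left hAm, lintegral_add_left hIm]
  exact ENNReal.add_lt_top.2 ⟨hA, ENNReal.add_lt_top.2 ⟨hI, hΦi⟩⟩

/-- Hölder continuity plus exponential integrability imply the weighted integrability
of the Fourier transform. -/
theorem stmt19 (f : ℝ → ℝ) (θ : ℝ) (hθ : 0 < θ)
    (hHolder : ∀ x y : ℝ, x ≠ y → |f x - f y| ≤ |x - y| ^ θ)
    (c : ℝ) (hc : 0 < c)
    (hint : Integrable (fun x => |f x| * Real.exp (c * |x|))) :
    ∫⁻ t : ℝ, ENNReal.ofReal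
        (‖(∫ x : ℝ, (f x : ℂ) * Complex.exp (Complex.I * t * x))‖
          / (1 + |t|) ^ (1/2 : ℝ)) < ⊤ := by
  have hfc : Continuous f := by
    rw [continuous_iff_continuousAt]
    intro x
    rw [ContinuousAt, tendsto_iff_dist_tendsto_zero]
    have hlim : Filter.Tendsto (fun y => |y - x| ^ θ) (nhds x) (nhds 0) := by
      have : Continuous fun y : ℝ => |y - x| ^ θ :=
        Continuous.rpow_const (by fun_prop) fun _ => Or.inr hθ.le
      simpa [Real.zero_rpow hθ.ne'] using this.tendsto x
    refine squeeze_zero (fun _ => dist_nonneg) (fun y => ?_) hlim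
    rcases eq_or_ne y x with rfl | hne
    · rw [dist_self]
      positivity
    · exact hHolder y x hne
  have hg : Integrable fun x => (f x : ℂ) := by
    refine hint.mono' (by fun_prop) (Filter.Eventually.of_forall fun x => ?_)
    rw [Complex.norm_real, Real.norm_eq_abs]
    exact le_mul_of_one_le_right (abs_nonneg _) (Real.one_le_exp (by positivity))
  have hH : ∀ h, 0 < h → ∀ x, ‖(f (x + h) : ℂ) - f x‖ ≤ h ^ θ := by
    intro h hh x
    rw [← Complex.ofReal_sub, Complex.norm_real, Real.norm_eq_abs]
    simpa [abs_of_pos hh] using hHolder (x + h) x (by simpa using hh.ne')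
  have hscale := (integrable_fourier_div_of_holder hθ hg hH).comp_mul_left'
    (R := -(2 * π)⁻¹) (by simp [Real.pi_ne_zero])
  refine lt_of_le_of_lt (lintegral_mono fun t => ENNReal.ofReal_le_ofReal ?_)
    hscale.lintegral_lt_top
  have hF : ∫ x : ℝ, (f x : ℂ) * Complex.exp (Complex.I * t * x)
      = 𝓕 (fun x => (f x : ℂ)) (-(2 * π)⁻¹ * t) := by
    rw [Real.fourier_real_eq_integral_exp_smul]
    refine integral_congr_ae (Filter.Eventually.of_forall fun x => ?_)
    simp only [smul_eq_mul]
    rw [mul_comm]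
    congr 2
    have : -2 * π * x * (-(2 * π)⁻¹ * t) = t * x := by
      field_simp
    rw [this]
    push_cast
    ring
  rw [hF]
  have hpi : (2 * π)⁻¹ ≤ 1 := inv_le_one_of_one_le₀ (by nlinarith [Real.pi_gt_three])
  have habs : |-(2 * π)⁻¹ * t| ≤ |t| := by
    rw [abs_mul, abs_neg, abs_of_pos (inv_pos.2 Real.two_pi_pos)]
    exact mul_le_of_le_one_left (abs_nonneg _) hpi
  gcongr
end
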